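/- arXiv:2306.06745 — 3 statements merged into one kernel-verified Lean document; each statement's English description precedes it below -/
import Mathlib

section
/- Every algebraic L-space is a continuous L-space: if X is an L-space such that core U is dense in U for every clopen upset U of X, then ker U is dense in U for every clopen upset U of X. -/
open Set Topology

/-- Clopen upsets of a topological space with a partial order. -/
def ClopUp (X : Type*) [TopologicalSpace X] [Preorder X] : Set (Set X) :=
  {U | IsClopen U ∧ IsUpperSet U}

/-- Downward closure of a set. -/
def downClosure (X : Type*) [Preorder X] (A : Set X) : Set X := {x | ∃ y ∈ A, x ≤ y}

/-- Priestley space: compact, and clopen upsets separate points via the Priestley separation axiom. -/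
def IsPriestley (X : Type*) [TopologicalSpace X] [Preorder X] : Prop :=
  CompactSpace X ∧ ∀ x y : X, ¬x ≤ y → ∃ U ∈ ClopUp X, x ∈ U ∧ y ∉ U

/-- Esakia space: a Priestley space in which downward closures of clopens are clopen. -/
def IsEsakia (X : Type*) [TopologicalSpace X] [Preorder X] : Prop :=
  IsPriestley X ∧ ∀ U : Set X, IsClopen U → IsClopen (downClosure X U)

/-- L-space: an extremally order-disconnected Esakia space. -/
def IsLSpace (X : Type*) [TopologicalSpace X] [Preorder X] : Prop :=
  IsEsakia X ∧ ∀ U : Set X, IsOpen U → IsUpperSet U → IsOpen (closure U)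

/-- The spatial part of an L-space: points with clopen downset. -/
def spatialPart (X : Type*) [TopologicalSpace X] [Preorder X] : Set X :=
  {y : X | IsClopen {x : X | x ≤ y}}

/-- Scott upset: a closed upset all of whose minimal points lie in the spatial part. -/
def IsScottUpset (X : Type*) [TopologicalSpace X] [Preorder X] (F : Set X) : Prop :=
  IsClosed F ∧ IsUpperSet F ∧ ∀ y ∈ F, (∀ z ∈ F, z ≤ y → z = y) → y ∈ spatialPart X

/-- Clopen Scott upsets. -/
def ClopSUp (X : Type*) [TopologicalSpace X] [Preorder X] : Set (Set X) :=
  {U | IsClopen U ∧ IsScottUpset X U}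

/-- Clopen bisets (both upsets and downsets). -/
def ClopBi (X : Type*) [TopologicalSpace X] [Preorder X] : Set (Set X) :=
  {U | IsClopen U ∧ IsUpperSet U ∧ IsLowerSet U}

/-- `V ≪ U` for clopen upsets: every open upset whose closure contains `U` contains `V`. -/
def wayBelowSet (X : Type*) [TopologicalSpace X] [Preorder X] (V U : Set X) : Prop :=
  ∀ W : Set X, IsOpen W → IsUpperSet W → U ⊆ closure W → V ⊆ W

/-- The kernel of a clopen upset. -/
def kerSet (X : Type*) [TopologicalSpace X] [Preorder X] (U : Set X) : Set X :=
  ⋃₀ {V | V ∈ ClopUp X ∧ wayBelowSet X V U}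

/-- The core of a clopen upset. -/
def coreSet (X : Type*) [TopologicalSpace X] [Preorder X] (U : Set X) : Set X :=
  ⋃₀ {V | V ∈ ClopSUp X ∧ V ⊆ U}

/-- The regular part of a clopen upset. -/
def regSet (X : Type*) [TopologicalSpace X] [Preorder X] (U : Set X) : Set X :=
  ⋃₀ {V | V ∈ ClopUp X ∧ downClosure X V ⊆ U}

/-- The center of a clopen upset. -/
def cenSet (X : Type*) [TopologicalSpace X] [Preorder X] (U : Set X) : Set X :=
  ⋃₀ {V | V ∈ ClopBi X ∧ V ⊆ U}

/-- The topology on the spatial part, generated by traces of clopen upsets. -/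
def spatialTop (X : Type*) [TopologicalSpace X] [Preorder X] :
    TopologicalSpace (spatialPart X) :=
  TopologicalSpace.generateFrom
    {V : Set (spatialPart X) | ∃ U ∈ ClopUp X, V = ((↑) : spatialPart X → X) ⁻¹' U}

/-- An algebraic L-space: the core of every clopen upset is dense in it. -/
def IsAlgebraicLSpace (X : Type*) [TopologicalSpace X] [Preorder X] : Prop :=
  IsLSpace X ∧ ∀ U ∈ ClopUp X, U ⊆ closure (coreSet X U)

/-- A space is compactly based if compact open sets form a basis. -/
def CompactlyBased (Y : Type*) [TopologicalSpace Y] : Prop :=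
  ∀ V : Set Y, IsOpen V → ∀ y ∈ V, ∃ K : Set Y, IsOpen K ∧ IsCompact K ∧ y ∈ K ∧ K ⊆ V

/-- A set is saturated if it is the intersection of the open sets containing it. -/
def IsSaturatedSet {Y : Type*} [TopologicalSpace Y] (K : Set Y) : Prop :=
  K = ⋂₀ {U : Set Y | IsOpen U ∧ K ⊆ U}

/-- The way-below relation in a frame. -/
def frameWayBelow {L : Type*} [Order.Frame L] (a b : L) : Prop :=
  ∀ S : Set L, b ≤ sSup S → ∃ T : Set L, T ⊆ S ∧ T.Finite ∧ a ≤ sSup T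

/-- A compact element of a frame. -/
def IsCompactElt {L : Type*} [Order.Frame L] (a : L) : Prop := frameWayBelow a a

/-- An algebraic frame: every element is the join of the compact elements below it. -/
def AlgebraicFrame (L : Type*) [Order.Frame L] : Prop :=
  ∀ a : L, a = sSup {k : L | IsCompactElt k ∧ k ≤ a}

/-- An arithmetic frame: algebraic with stable way-below relation. -/
def ArithmeticFrame (L : Type*) [Order.Frame L] : Prop :=
  AlgebraicFrame L ∧
    ∀ a b c : L, frameWayBelow a b → frameWayBelow a c → frameWayBelow a (b ⊓ c)

/-- A coherent frame: arithmetic and compact. -/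
def CoherentFrame (L : Type*) [Order.Frame L] : Prop :=
  ArithmeticFrame L ∧ IsCompactElt (⊤ : L)

/-- A prime filter of a frame. -/
def IsPrimeFilter {L : Type*} [Order.Frame L] (F : Set L) : Prop :=
  F.Nonempty ∧ F ≠ Set.univ ∧ (∀ a ∈ F, ∀ b : L, a ≤ b → b ∈ F) ∧
    (∀ a ∈ F, ∀ b ∈ F, a ⊓ b ∈ F) ∧ ∀ a b : L, a ⊔ b ∈ F → a ∈ F ∨ b ∈ F

/-- A completely prime filter of a frame. -/
def IsCompletelyPrimeFilter {L : Type*} [Order.Frame L] (F : Set L) : Prop :=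
  F.Nonempty ∧ F ≠ Set.univ ∧ (∀ a ∈ F, ∀ b : L, a ≤ b → b ∈ F) ∧
    (∀ a ∈ F, ∀ b ∈ F, a ⊓ b ∈ F) ∧ ∀ S : Set L, sSup S ∈ F → ∃ s ∈ S, s ∈ F

/-- The Priestley space of a frame: prime filters ordered by inclusion. -/
abbrev PriestleyDual (L : Type*) [Order.Frame L] : Type _ := {F : Set L // IsPrimeFilter F}

/-- The Priestley topology on the Priestley space of a frame. -/
instance PriestleyDual.instTopologicalSpace (L : Type*) [Order.Frame L] :
    TopologicalSpace (PriestleyDual L) :=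
  TopologicalSpace.generateFrom
    ({S : Set (PriestleyDual L) | ∃ a : L, S = {x | a ∈ x.val}} ∪
     {S : Set (PriestleyDual L) | ∃ a : L, S = {x | a ∈ x.val}ᶜ})

/-- Principal downsets of a Priestley space are closed. -/
theorem IsPriestley.isClosed_Iic {X : Type*} [TopologicalSpace X] [Preorder X]
    (hX : IsPriestley X) (y : X) : IsClosed (Iic y) := by
  refine isOpen_compl_iff.mp (isOpen_iff_forall_mem_open.mpr fun x hx => ?_)
  obtain ⟨U, hU, hxU, hyU⟩ := hX.2 x y hx
  exact ⟨U, fun z hz hzy => hyU (hU.2 hzy hz), hU.1.isOpen, hxU⟩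

/-- Every point of a closed subset of a Priestley space lies above a minimal point of it. -/
theorem IsPriestley.exists_le_minimal {X : Type*} [TopologicalSpace X] [PartialOrder X]
    (hX : IsPriestley X) {F : Set X} (hF : IsClosed F) {x : X} (hx : x ∈ F) :
    ∃ y ≤ x, Minimal (· ∈ F) y := by
  have := hX.1
  refine zorn_le_nonempty₀ (α := Xᵒᵈ) F (fun c hcF hc z hz => ?_) x hx
  have : Nonempty c := ⟨⟨z, hz⟩⟩
  have hdir : Directed (· ⊇ ·) fun a : c => F ∩ Iic (α := X) a.1 := by
    intro a b
    rcases hc.total a.2 b.2 with h | h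
    · exact ⟨b, fun _ hw => ⟨hw.1, le_trans (α := X) hw.2 h⟩, Subset.rfl⟩
    · exact ⟨a, Subset.rfl, fun _ hw => ⟨hw.1, le_trans (α := X) hw.2 h⟩⟩
  have hclosed (a : c) : IsClosed (F ∩ Iic (α := X) a.1) := hF.inter (hX.isClosed_Iic _)
  obtain ⟨w, hw⟩ := IsCompact.nonempty_iInter_of_directed_nonempty_isCompact_isClosed _ hdir
    (fun a => ⟨a.1, hcF a.2, le_refl (α := X) _⟩) (fun a => (hclosed a).isCompact) hclosed
  rw [mem_iInter] at hw
  exact ⟨w, (hw ⟨z, hz⟩).1, fun a ha => (hw ⟨a, ha⟩).2⟩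

/-- An open upset contains every point of the spatial part lying in its closure. -/
theorem mem_of_mem_spatialPart_of_mem_closure {X : Type*} [TopologicalSpace X] [Preorder X]
    {W : Set X} (hW : IsUpperSet W) {y : X} (hy : y ∈ spatialPart X) (hyW : y ∈ closure W) :
    y ∈ W := by
  obtain ⟨w, hwy, hw⟩ := mem_closure_iff.mp hyW _ hy.isOpen (le_refl y)
  exact hW hwy hw

/-- A Scott upset contained in `U` is way below `U`. -/
theorem IsScottUpset.wayBelowSet {X : Type*} [TopologicalSpace X] [PartialOrder X]
    (hX : IsPriestley X) {V U : Set X} (hV : IsScottUpset X V) (hVU : V ⊆ U) :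
    wayBelowSet X V U := by
  intro W _ hW hUW x hx
  obtain ⟨y, hyx, hy⟩ := hX.exists_le_minimal hV.1 hx
  have hys : y ∈ spatialPart X :=
    hV.2.2 y hy.prop fun z hz hzy => le_antisymm hzy (hy.le_of_le hz hzy)
  exact hW hyx (mem_of_mem_spatialPart_of_mem_closure hW hys (hUW (hVU hy.prop)))

/-- The core of a set is contained in its kernel. -/
theorem coreSet_subset_kerSet {X : Type*} [TopologicalSpace X] [PartialOrder X]
    (hX : IsPriestley X) (U : Set X) : coreSet X U ⊆ kerSet X U :=
  sUnion_subset_sUnion fun _ hV =>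
    ⟨⟨hV.1.1, hV.1.2.2.1⟩, hV.1.2.wayBelowSet hX hV.2⟩

/-- every algebraic L-space is a continuous L-space. -/
theorem stmt2 {X : Type*} [TopologicalSpace X] [PartialOrder X]
    (hX : IsLSpace X) (halg : ∀ U ∈ ClopUp X, U ⊆ closure (coreSet X U)) :
    ∀ U ∈ ClopUp X, U ⊆ closure (kerSet X U) :=
  fun U hU => (halg U hU).trans (closure_mono (coreSet_subset_kerSet hX.1.1 U))
end

section
/- Let X be an SL-space with spatial part Y. Then X is an algebraic L-space if and only if Y is a compactly based sober space. -/
open Set Topology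

section LSpace

variable {X : Type*} [TopologicalSpace X] [PartialOrder X]

theorem univ_mem_clopUp : (univ : Set X) ∈ ClopUp X := ⟨isClopen_univ, isUpperSet_univ⟩

theorem inter_mem_clopUp {U V : Set X} (hU : U ∈ ClopUp X) (hV : V ∈ ClopUp X) :
    U ∩ V ∈ ClopUp X :=
  ⟨hU.1.inter hV.1, hU.2.inter hV.2⟩

theorem IsPriestley.isClosed_Iic_s7 (hX : IsPriestley X) (x : X) : IsClosed {z : X | z ≤ x} := by
  rw [← isOpen_compl_iff, isOpen_iff_forall_mem_open]
  intro y hy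
  obtain ⟨U, hU, hyU, hxU⟩ := hX.2 y x hy
  exact ⟨U, fun z hz hzx => hxU (hU.2 hzx hz), hU.1.isOpen, hyU⟩

/-- In a Priestley space every open upset is a union of clopen upsets. -/
theorem IsPriestley.exists_clopUp_subset (hX : IsPriestley X) {W : Set X} (hW : IsOpen W)
    (hWu : IsUpperSet W) {x : X} (hx : x ∈ W) : ∃ A ∈ ClopUp X, x ∈ A ∧ A ⊆ W := by
  have := hX.1
  let ι := {A : Set X // A ∈ ClopUp X ∧ x ∈ A}
  have : Nonempty ι := ⟨⟨univ, univ_mem_clopUp, mem_univ x⟩⟩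
  obtain ⟨A, hA⟩ := hW.isClosed_compl.isCompact.elim_directed_cover
    (fun A : ι => (A : Set X)ᶜ) (fun A => A.2.1.1.compl.isOpen)
    (fun y hy => by
      obtain ⟨U, hU, hxU, hyU⟩ := hX.2 x y fun hxy => hy (hWu hxy hx)
      exact mem_iUnion.2 ⟨⟨U, hU, hxU⟩, hyU⟩)
    (fun A B => ⟨⟨A ∩ B, inter_mem_clopUp A.2.1 B.2.1, A.2.2, B.2.2⟩,
      compl_subset_compl.2 inter_subset_left, compl_subset_compl.2 inter_subset_right⟩)
  exact ⟨A, A.2.1, A.2.2, compl_subset_compl.1 hA⟩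

/-- In a Priestley space every point of a closed set lies above a minimal point of that set. -/
theorem IsPriestley.exists_minimal_le (hX : IsPriestley X) {F : Set X} (hF : IsClosed F) {x : X}
    (hx : x ∈ F) : ∃ m ∈ F, m ≤ x ∧ ∀ z ∈ F, z ≤ m → z = m := by
  have := hX.1
  obtain ⟨m, hmx, hm⟩ := zorn_le_nonempty₀ (α := Xᵒᵈ) (OrderDual.ofDual ⁻¹' F)
    (fun c hcF hc y hy => by
      have : Nonempty c := ⟨⟨y, hy⟩⟩
      obtain ⟨z, hz⟩ := IsCompact.nonempty_iInter_of_directed_nonempty_isCompact_isClosed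
        (fun a : c => F ∩ {z : X | z ≤ OrderDual.ofDual a.1})
        (fun a b => by
          rcases hc.total a.2 b.2 with h | h
          · exact ⟨b, fun z hz => ⟨hz.1, le_trans hz.2 (OrderDual.ofDual_le_ofDual.2 h)⟩,
              Subset.rfl⟩
          · exact ⟨a, Subset.rfl,
              fun z hz => ⟨hz.1, le_trans hz.2 (OrderDual.ofDual_le_ofDual.2 h)⟩⟩)
        (fun a => ⟨OrderDual.ofDual a.1, hcF a.2, le_rfl⟩)
        (fun a => (hF.inter (hX.isClosed_Iic_s7 _)).isCompact)
        (fun a => hF.inter (hX.isClosed_Iic_s7 _))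
      rw [mem_iInter] at hz
      exact ⟨OrderDual.toDual z, (hz ⟨y, hy⟩).1, fun a ha => (hz ⟨a, ha⟩).2⟩)
    (OrderDual.toDual x) hx
  exact ⟨OrderDual.ofDual m, hm.1, hmx, fun z hz hzm =>
    le_antisymm hzm (hm.2 (y := OrderDual.toDual z) hz hzm)⟩

theorem IsLSpace.closure_mem_clopUp (hX : IsLSpace X) {W : Set X} (hW : IsOpen W)
    (hWu : IsUpperSet W) : closure W ∈ ClopUp X := by
  have hc : IsClopen (closure W) := ⟨isClosed_closure, hX.2 W hW hWu⟩
  refine ⟨hc, fun y z hyz hy => ?_⟩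
  by_contra hz
  obtain ⟨w, ⟨n, hn, hwn⟩, hwW⟩ := mem_closure_iff.1 hy _ (hX.1.2 _ hc.compl).isOpen ⟨z, hz, hyz⟩
  exact hn (subset_closure (hWu hwn hwW))

theorem mem_of_mem_closure_of_mem_spatialPart {W : Set X} (hWu : IsUpperSet W) {y : X}
    (hy : y ∈ spatialPart X) (hyW : y ∈ closure W) : y ∈ W := by
  obtain ⟨w, hwy, hwW⟩ := mem_closure_iff.1 hyW _ (IsClopen.isOpen hy) le_rfl
  exact hWu hwy hwW

/-- The open sets of the spatial part are exactly the traces of clopen upsets. -/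
theorem IsLSpace.isOpen_spatialTop_iff (hX : IsLSpace X) {V : Set (spatialPart X)} :
    IsOpen[spatialTop X] V ↔ ∃ U ∈ ClopUp X, V = ((↑) : spatialPart X → X) ⁻¹' U := by
  refine ⟨fun h => ?_, fun h => TopologicalSpace.isOpen_generateFrom_of_mem h⟩
  induction h with
  | basic s hs => exact hs
  | univ => exact ⟨univ, univ_mem_clopUp, rfl⟩
  | inter s t _ _ hs ht =>
    obtain ⟨U, hU, rfl⟩ := hs
    obtain ⟨U', hU', rfl⟩ := ht
    exact ⟨U ∩ U', inter_mem_clopUp hU hU', rfl⟩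
  | sUnion S _ ih =>
    let T : Set (Set X) := {U | U ∈ ClopUp X ∧ ((↑) : spatialPart X → X) ⁻¹' U ∈ S}
    have hTu : IsUpperSet (⋃₀ T) := isUpperSet_sUnion fun U hU => hU.1.2
    refine ⟨closure (⋃₀ T),
      hX.closure_mem_clopUp (isOpen_sUnion fun U hU => hU.1.1.isOpen) hTu, ?_⟩
    ext y
    constructor
    · rintro ⟨s, hs, hys⟩
      obtain ⟨U, hU, rfl⟩ := ih s hs
      exact subset_closure ⟨U, ⟨hU, hs⟩, hys⟩
    · intro hy
      obtain ⟨U, hU, hyU⟩ := mem_of_mem_closure_of_mem_spatialPart hTu y.2 hy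
      exact ⟨_, hU.2, hyU⟩

theorem subset_of_spatialPart_preimage_subset (hSL : Dense (spatialPart X)) {U V : Set X}
    (hU : IsOpen U) (hV : IsClosed V)
    (h : ((↑) : spatialPart X → X) ⁻¹' U ⊆ ((↑) : spatialPart X → X) ⁻¹' V) : U ⊆ V :=
  (hSL.open_subset_closure_inter hU).trans
    (closure_minimal (fun y hy => h (show (⟨y, hy.2⟩ : spatialPart X) ∈ _ from hy.1)) hV)

theorem IsLSpace.isCompact_preimage_of_isScottUpset (hX : IsLSpace X) {V : Set X}
    (hV : IsScottUpset X V) :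
    @IsCompact _ (spatialTop X) (((↑) : spatialPart X → X) ⁻¹' V) := by
  have := hX.1.1.1
  let := spatialTop X
  refine isCompact_of_finite_subcover fun {ι} U hUo hVU => ?_
  choose A hA hUA using fun i => hX.isOpen_spatialTop_iff.1 (hUo i)
  obtain ⟨t, ht⟩ := hV.1.isCompact.elim_finite_subcover A (fun i => (hA i).1.isOpen)
    (fun x hx => by
      obtain ⟨m, hmV, hmx, hm⟩ := hX.1.1.exists_minimal_le hV.1 hx
      obtain ⟨i, hi⟩ := mem_iUnion.1
        (hVU (show (⟨m, hV.2.2 m hmV hm⟩ : spatialPart X) ∈ _ from hmV))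
      rw [hUA i] at hi
      exact mem_iUnion.2 ⟨i, (hA i).2 hmx hi⟩)
  refine ⟨t, fun y hy => ?_⟩
  simpa [hUA] using ht hy

/-- If the spatial part is dense, then clopen upsets with compact trace are Scott upsets. -/
theorem IsLSpace.isScottUpset_of_isCompact_preimage (hX : IsLSpace X)
    (hSL : Dense (spatialPart X)) {V : Set X} (hV : V ∈ ClopUp X)
    (hVc : @IsCompact _ (spatialTop X) (((↑) : spatialPart X → X) ⁻¹' V)) : IsScottUpset X V := by
  refine ⟨hV.1.isClosed, hV.2, fun x hx hmin => ?_⟩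
  set W : Set X := V \ {z | z ≤ x} with hW
  have hWo : IsOpen W := hV.1.isOpen.sdiff (hX.1.1.isClosed_Iic_s7 x)
  have hWu : IsUpperSet W := fun a b hab ha => ⟨hV.2 hab ha.1, fun hb => ha.2 (hab.trans hb)⟩
  have hxW : x ∉ closure W := by
    intro hxW
    have hVW : V ⊆ closure W := fun z hz => by
      by_cases hzx : z ≤ x
      · rwa [hmin z hz hzx]
      · exact subset_closure ⟨hz, hzx⟩
    let ι := {A : Set X // A ∈ ClopUp X ∧ A ⊆ W}
    have : Nonempty ι := ⟨⟨∅, ⟨isClopen_empty, isUpperSet_empty⟩, empty_subset _⟩⟩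
    let := spatialTop X
    obtain ⟨A, hA⟩ := hVc.elim_directed_cover
      (fun A : ι => ((↑) : spatialPart X → X) ⁻¹' A)
      (fun A => hX.isOpen_spatialTop_iff.2 ⟨A, A.2.1, rfl⟩)
      (fun y hy => by
        obtain ⟨A, hA, hyA, hAW⟩ := hX.1.1.exists_clopUp_subset hWo hWu
          (mem_of_mem_closure_of_mem_spatialPart hWu y.2 (hVW hy))
        exact mem_iUnion.2 ⟨⟨A, hA, hAW⟩, hyA⟩)
      (fun A B => ⟨⟨A ∪ B, ⟨A.2.1.1.union B.2.1.1, A.2.1.2.union B.2.1.2⟩,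
        union_subset A.2.2 B.2.2⟩, preimage_mono subset_union_left,
        preimage_mono subset_union_right⟩)
    have hVA := subset_of_spatialPart_preimage_subset hSL hV.1.isOpen A.2.1.1.isClosed hA
    exact (A.2.2 (hVA hx)).2 le_rfl
  have hsing : {x} = V \ closure W := by
    ext z
    refine ⟨fun hz => by rw [mem_singleton_iff.1 hz]; exact ⟨hx, hxW⟩, fun hz => ?_⟩
    by_contra hzx
    exact hz.2 (subset_closure ⟨hz.1, fun h => hzx (hmin z hz.1 h)⟩)
  have hclopen := hX.1.2 {x} (hsing ▸ hV.1.diff (hX.closure_mem_clopUp hWo hWu).1)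
  simpa [downClosure, spatialPart] using hclopen

theorem IsLSpace.t0Space_spatialTop (hX : IsLSpace X) :
    @T0Space (spatialPart X) (spatialTop X) := by
  let := spatialTop X
  have hle : ∀ x y : spatialPart X, Inseparable x y → (x : X) ≤ y := fun x y hxy => by
    by_contra h
    obtain ⟨U, hU, hxU, hyU⟩ := hX.1.1.2 _ _ h
    exact hyU ((hxy.mem_open_iff (hX.isOpen_spatialTop_iff.2 ⟨U, hU, rfl⟩)).1 hxU)
  exact ⟨fun x y hxy => Subtype.ext (le_antisymm (hle x y hxy) (hle y x hxy.symm))⟩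

/-- The spatial part is quasi-sober as soon as it is dense. -/
theorem IsLSpace.quasiSober_spatialTop (hX : IsLSpace X) (hSL : Dense (spatialPart X)) :
    @QuasiSober (spatialPart X) (spatialTop X) := by
  have := hX.1.1.1
  let := spatialTop X
  refine ⟨fun {C} hC hCc => ?_⟩
  obtain ⟨U, hU, hCU⟩ := hX.isOpen_spatialTop_iff.1 hCc.isOpen_compl
  have hmemC : ∀ y : spatialPart X, y ∈ C ↔ (y : X) ∉ U := fun y => by
    rw [← not_iff_not, ← mem_compl_iff, hCU]; simp
  have hmeet : ∀ A ∈ ClopUp X, (Uᶜ ∩ A).Nonempty →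
      (C ∩ ((↑) : spatialPart X → X) ⁻¹' A).Nonempty := fun A hA hne => by
    obtain ⟨y, hy, hyY⟩ := hSL.inter_open_nonempty _ (hU.1.compl.isOpen.inter hA.1.isOpen) hne
    exact ⟨⟨y, hyY⟩, (hmemC _).2 hy.1, hy.2⟩
  obtain ⟨c, hc⟩ := hC.nonempty
  let ι := {A : Set X // A ∈ ClopUp X ∧ (Uᶜ ∩ A).Nonempty}
  have : Nonempty ι := ⟨⟨univ, univ_mem_clopUp, c, (hmemC c).1 hc, mem_univ _⟩⟩
  have hcl : ∀ A : ι, IsClosed (Uᶜ ∩ (A : Set X)) :=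
    fun A => (hU.1.compl.inter A.2.1.1).isClosed
  obtain ⟨x, hx⟩ := IsCompact.nonempty_iInter_of_directed_nonempty_isCompact_isClosed
    (fun A : ι => Uᶜ ∩ (A : Set X))
    (fun A B => by
      obtain ⟨y, hyC, hyA, hyB⟩ := hC.isPreirreducible _ _
        (hX.isOpen_spatialTop_iff.2 ⟨A, A.2.1, rfl⟩) (hX.isOpen_spatialTop_iff.2 ⟨B, B.2.1, rfl⟩)
        (hmeet A A.2.1 A.2.2) (hmeet B B.2.1 B.2.2)
      exact ⟨⟨A ∩ B, inter_mem_clopUp A.2.1 B.2.1, y, (hmemC y).1 hyC, hyA, hyB⟩,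
        inter_subset_inter_right _ inter_subset_left,
        inter_subset_inter_right _ inter_subset_right⟩)
    (fun A => A.2.2) (fun A => (hcl A).isCompact) hcl
  rw [mem_iInter] at hx
  have hxU : x ∉ U := (hx ⟨univ, univ_mem_clopUp, c, (hmemC c).1 hc, mem_univ _⟩).1
  have hle : ∀ d ∉ U, d ≤ x := fun d hd => by
    by_contra h
    obtain ⟨A, hA, hdA, hxA⟩ := hX.1.1.2 _ _ h
    exact hxA (hx ⟨A, hA, d, hd, hdA⟩).2
  have hIic : {z : X | z ≤ x} = Uᶜ :=
    Subset.antisymm (fun z hz hzU => hxU (hU.2 hz hzU)) hle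
  have hxY : x ∈ spatialPart X := by
    change IsClopen {z : X | z ≤ x}
    exact hIic ▸ hU.1.compl
  refine ⟨⟨x, hxY⟩, Subset.antisymm (closure_minimal ?_ hCc) fun y hy => ?_⟩
  · exact singleton_subset_iff.2 ((hmemC _).2 hxU)
  · refine mem_closure_iff.2 fun O hO hyO => ⟨⟨x, hxY⟩, ?_, rfl⟩
    obtain ⟨A, hA, rfl⟩ := hX.isOpen_spatialTop_iff.1 hO
    exact hA.2 (hle y ((hmemC y).1 hy)) hyO

theorem IsLSpace.compactlyBased_spatialTop (hX : IsLSpace X)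
    (hcore : ∀ U ∈ ClopUp X, U ⊆ closure (coreSet X U)) :
    @CompactlyBased (spatialPart X) (spatialTop X) := by
  intro V hV y hy
  obtain ⟨U, hU, rfl⟩ := hX.isOpen_spatialTop_iff.1 hV
  obtain ⟨K, ⟨hK, hKU⟩, hyK⟩ := mem_of_mem_closure_of_mem_spatialPart
    (isUpperSet_sUnion fun K hK => hK.1.2.2.1) y.2 (hcore U hU hy)
  exact ⟨_, hX.isOpen_spatialTop_iff.2 ⟨K, ⟨hK.1, hK.2.2.1⟩, rfl⟩,
    hX.isCompact_preimage_of_isScottUpset hK.2, hyK, preimage_mono hKU⟩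

theorem IsLSpace.subset_closure_coreSet (hX : IsLSpace X) (hSL : Dense (spatialPart X))
    (hY : @CompactlyBased (spatialPart X) (spatialTop X)) {U : Set X} (hU : U ∈ ClopUp X) :
    U ⊆ closure (coreSet X U) := by
  refine (hSL.open_subset_closure_inter hU.1.isOpen).trans (closure_mono ?_)
  rintro y ⟨hyU, hyY⟩
  obtain ⟨K, hKo, hKc, hyK, hKU⟩ :=
    hY _ (hX.isOpen_spatialTop_iff.2 ⟨U, hU, rfl⟩) ⟨y, hyY⟩ hyU
  obtain ⟨V, hV, rfl⟩ := hX.isOpen_spatialTop_iff.1 hKo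
  exact ⟨V, ⟨⟨hV.1, hX.isScottUpset_of_isCompact_preimage hSL hV hKc⟩,
    subset_of_spatialPart_preimage_subset hSL hV.1.isOpen hU.1.isClosed hKU⟩, hyK⟩

end LSpace

/-- an SL-space is an algebraic L-space iff its spatial part is a
compactly based sober space. -/
theorem stmt7 {X : Type*} [TopologicalSpace X] [PartialOrder X]
    (hX : IsLSpace X) (hSL : Dense (spatialPart X)) :
    (∀ U ∈ ClopUp X, U ⊆ closure (coreSet X U)) ↔
      (@CompactlyBased (spatialPart X) (spatialTop X) ∧
        @T0Space (spatialPart X) (spatialTop X) ∧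
        @QuasiSober (spatialPart X) (spatialTop X)) :=
  ⟨fun h => ⟨hX.compactlyBased_spatialTop h, hX.t0Space_spatialTop, hX.quasiSober_spatialTop hSL⟩,
    fun h _ hU => hX.subset_closure_coreSet hSL h.1 hU⟩
end

section
/- Let X be an algebraic L-space. Then X is kernel-stable (i.e., ker(U ∩ V) = ker U ∩ ker V for all clopen upsets U, V) if and only if U ∩ V is a clopen Scott upset for all clopen Scott upsets U, V of X. -/
open Set Topology

section

variable {X : Type*} [TopologicalSpace X]

theorem IsPriestley.priestleySpace [Preorder X] (h : IsPriestley X) : PriestleySpace X where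
  priestley {x y} hxy :=
    let ⟨U, ⟨hU, hU'⟩, hx, hy⟩ := h.2 x y hxy
    ⟨U, hU, hU', hx, hy⟩

theorem PriestleySpace.closedIicTopology [Preorder X] [PriestleySpace X] :
    ClosedIicTopology X where
  isClosed_Iic y := by
    rw [← isOpen_compl_iff, isOpen_iff_forall_mem_open]
    intro x hx
    obtain ⟨U, hU, hup, hxU, hyU⟩ := exists_isClopen_upper_of_not_le (show ¬x ≤ y from hx)
    exact ⟨U, fun z hz hzy => hyU (hup hzy hz), hU.isOpen, hxU⟩

/-- In a compact space with closed principal downsets, every point of a closed set lies above a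
minimal point of that set. -/
theorem IsClosed.exists_minimal_le [Preorder X] [CompactSpace X] [ClosedIicTopology X]
    {F : Set X} (hF : IsClosed F) {x : X} (hx : x ∈ F) : ∃ y ≤ x, Minimal (· ∈ F) y := by
  refine zorn_le_nonempty₀ (α := Xᵒᵈ) F (fun c hcF hc y hy => ?_) x hx
  have : Nonempty c := ⟨⟨y, hy⟩⟩
  have hclosed : ∀ i : c, IsClosed (F ∩ Iic (OrderDual.ofDual i.1)) :=
    fun i => hF.inter isClosed_Iic
  obtain ⟨z, hz⟩ := IsCompact.nonempty_iInter_of_directed_nonempty_isCompact_isClosed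
    (fun i : c => F ∩ Iic (OrderDual.ofDual i.1))
    (fun i j => by
      rcases hc.total i.2 j.2 with h | h
      · exact ⟨j, fun w hw => ⟨hw.1, le_trans hw.2 h⟩, subset_rfl⟩
      · exact ⟨i, subset_rfl, fun w hw => ⟨hw.1, le_trans hw.2 h⟩⟩)
    (fun i => ⟨i.1, hcF i.2, le_rfl⟩) (fun i => (hclosed i).isCompact) hclosed
  rw [mem_iInter] at hz
  exact ⟨z, (hz ⟨y, hy⟩).1, fun w hw => (hz ⟨w, hw⟩).2⟩

theorem IsEsakia.isUpperSet_closure [PartialOrder X] (h : IsEsakia X) {W : Set X}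
    (hW : IsUpperSet W) : IsUpperSet (closure W) := by
  have := h.1.1
  have := h.1.priestleySpace
  intro x z hxz hx
  by_contra hz
  obtain ⟨N, hN, hzN, hNW⟩ := compact_exists_isClopen_in_isOpen isClosed_closure.isOpen_compl hz
  obtain ⟨w, ⟨n, hn, hwn⟩, hw⟩ := mem_closure_iff.1 hx _ (h.2 N hN).isOpen ⟨z, hzN, hxz⟩
  exact hNW hn (subset_closure (hW hwn hw))

theorem ClopSUp.mem_clopUp [Preorder X] {U : Set X} (hU : U ∈ ClopSUp X) : U ∈ ClopUp X :=
  ⟨hU.1, hU.2.2.1⟩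

/-- Clopen Scott upsets are exactly the clopen upsets that are way below themselves. -/
theorem IsEsakia.mem_clopSUp_iff [PartialOrder X] (h : IsEsakia X) {U : Set X}
    (hU : U ∈ ClopUp X) : U ∈ ClopSUp X ↔ wayBelowSet X U U := by
  have := h.1.1
  have := h.1.priestleySpace
  have := PriestleySpace.closedIicTopology (X := X)
  constructor
  · intro hS W _ hWup hUW x hx
    obtain ⟨y, hyx, hy⟩ := hU.1.isClosed.exists_minimal_le hx
    have hyY := hS.2.2.2 y hy.prop fun z hz hzy => hzy.antisymm (hy.le_of_le hz hzy)
    obtain ⟨w, hwy, hw⟩ := mem_closure_iff.1 (hUW hy.prop) _ hyY.isOpen le_rfl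
    exact hWup (le_trans hwy hyx) hw
  · intro hUU
    refine ⟨hU.1, hU.1.isClosed, hU.2, fun y hy hmin => ⟨isClosed_Iic, ?_⟩⟩
    set W : Set X := (Iic y)ᶜ
    have hWup : IsUpperSet W := (isLowerSet_Iic y).compl
    have hyW : y ∉ closure W := fun hyW => by
      refine hUU W isClosed_Iic.isOpen_compl hWup (fun x hx => ?_) hy le_rfl
      by_cases hxy : x ≤ y
      · exact hmin x hx hxy ▸ hyW
      · exact subset_closure hxy
    have hW : closure W ⊆ W := fun x hx hxy => hyW (h.isUpperSet_closure hWup hxy hx)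
    exact isClosed_compl_iff.1 (isClosed_of_closure_subset hW)

/-- In an algebraic L-space, the kernel and the core of a clopen upset coincide. -/
theorem IsAlgebraicLSpace.kerSet_eq_coreSet [PartialOrder X] (hX : IsAlgebraicLSpace X)
    {U : Set X} (hU : U ∈ ClopUp X) : kerSet X U = coreSet X U := by
  apply Subset.antisymm
  · refine sUnion_subset fun V ⟨_, hVU⟩ => hVU _ ?_ ?_ (hX.2 U hU)
    · exact isOpen_sUnion fun V hV => hV.1.1.isOpen
    · exact isUpperSet_sUnion fun V hV => hV.1.2.2.1
  · refine sUnion_subset_sUnion fun V ⟨hV, hVU⟩ => ⟨ClopSUp.mem_clopUp hV, fun W hW hWup hUW => ?_⟩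
    exact (hX.1.1.mem_clopSUp_iff (ClopSUp.mem_clopUp hV)).1 hV W hW hWup (hVU.trans hUW)

end

/-- an algebraic L-space is kernel-stable iff clopen Scott upsets are
closed under binary intersections. -/
theorem stmt9 {X : Type*} [TopologicalSpace X] [PartialOrder X]
    (hX : IsAlgebraicLSpace X) :
    (∀ U ∈ ClopUp X, ∀ V ∈ ClopUp X, kerSet X (U ∩ V) = kerSet X U ∩ kerSet X V) ↔
      ∀ U ∈ ClopSUp X, ∀ V ∈ ClopSUp X, U ∩ V ∈ ClopSUp X := by
  have hinter : ∀ {U V : Set X}, U ∈ ClopUp X → V ∈ ClopUp X → U ∩ V ∈ ClopUp X :=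
    fun hU hV => ⟨hU.1.inter hV.1, hU.2.inter hV.2⟩
  constructor
  · intro hker U hU V hV
    have hU' := ClopSUp.mem_clopUp hU
    have hV' := ClopSUp.mem_clopUp hV
    rw [hX.1.1.mem_clopSUp_iff (hinter hU' hV')]
    intro W hW hWup hUVW x hx
    have hxker : x ∈ kerSet X (U ∩ V) := by
      rw [hker U hU' V hV']
      exact ⟨⟨U, ⟨hU', (hX.1.1.mem_clopSUp_iff hU').1 hU⟩, hx.1⟩,
        ⟨V, ⟨hV', (hX.1.1.mem_clopSUp_iff hV').1 hV⟩, hx.2⟩⟩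
    obtain ⟨A, ⟨_, hA⟩, hxA⟩ := hxker
    exact hA W hW hWup hUVW hxA
  · intro hS U hU V hV
    rw [hX.kerSet_eq_coreSet (hinter hU hV), hX.kerSet_eq_coreSet hU, hX.kerSet_eq_coreSet hV]
    apply Subset.antisymm
    · rintro x ⟨A, ⟨hA, hAUV⟩, hxA⟩
      exact ⟨⟨A, ⟨hA, fun _ h => (hAUV h).1⟩, hxA⟩, ⟨A, ⟨hA, fun _ h => (hAUV h).2⟩, hxA⟩⟩
    · rintro x ⟨⟨A, ⟨hA, hAU⟩, hxA⟩, ⟨B, ⟨hB, hBV⟩, hxB⟩⟩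
      exact ⟨A ∩ B, ⟨hS A hA B hB, inter_subset_inter hAU hBV⟩, hxA, hxB⟩
end
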